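/- Let U(n,k) = (1)_n³ (1+k)_n² / [(1/2)_n · (1/2 + k/2)_n² · (1 + k/2)_n²], F(n,k) = U(n,k) · [1/(2n+k+1)²] · (1/64)^n, and G(n,k) = U(n,k) · [(21n³ + 55n² + 47n + 13 + 2k³ + 13k²n + 28kn² + 11k² + 48kn + 20k) / (2(2n+k+1)²(2n+1)(2n+k+2)²)] · (1/64)^n, where n ranges over the natural numbers and k over real numbers with k > −1. Then for all natural numbers n and all real k > −1, F(n+1,k) − F(n,k) = G(n,k+1) − G(n,k); that is, (F,G) is a WZ pair. -/

import Mathlib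

/-- The Pochhammer symbol (rising factorial): `poch a n = a (a+1) ⋯ (a+n-1)`. -/
noncomputable def poch (a : ℝ) (n : ℕ) : ℝ := (ascPochhammer ℝ n).eval a

/-- `U(n,k)` of the accelerated WZ pair for `ζ(2,a)`. -/
noncomputable def Uacc2 (n : ℕ) (k : ℝ) : ℝ :=
  (poch 1 n) ^ 3 * (poch (1 + k) n) ^ 2 /
    (poch (1 / 2) n * (poch (1 / 2 + k / 2) n) ^ 2 * (poch (1 + k / 2) n) ^ 2)

/-- `F(n,k)` of the accelerated WZ pair for `ζ(2,a)`. -/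
noncomputable def Facc2 (n : ℕ) (k : ℝ) : ℝ :=
  Uacc2 n k * (1 / (2 * (n : ℝ) + k + 1) ^ 2) * (1 / 64 : ℝ) ^ n

/-- `G(n,k)` of the accelerated WZ pair for `ζ(2,a)`. -/
noncomputable def Gacc2 (n : ℕ) (k : ℝ) : ℝ :=
  Uacc2 n k *
    ((21 * (n : ℝ) ^ 3 + 55 * (n : ℝ) ^ 2 + 47 * (n : ℝ) + 13 + 2 * k ^ 3 +
        13 * k ^ 2 * (n : ℝ) + 28 * k * (n : ℝ) ^ 2 + 11 * k ^ 2 + 48 * k * (n : ℝ) +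
        20 * k) /
      (2 * (2 * (n : ℝ) + k + 1) ^ 2 * (2 * (n : ℝ) + 1) * (2 * (n : ℝ) + k + 2) ^ 2)) *
    (1 / 64 : ℝ) ^ n

theorem poch_succ (a : ℝ) (n : ℕ) : poch a (n + 1) = poch a n * (a + n) := by
  simp [poch, ascPochhammer_succ_eval]

theorem mul_poch_add_one (a : ℝ) (n : ℕ) : a * poch (a + 1) n = poch a n * (a + n) := by
  rw [← poch_succ]
  simp [poch, ascPochhammer_succ_left, Polynomial.eval_comp]

theorem Uacc2_succ (n : ℕ) (k : ℝ) :
    Uacc2 (n + 1) k = Uacc2 n k * (32 * ((n : ℝ) + 1) ^ 3 * (n + k + 1) ^ 2 /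
      ((2 * n + 1) * (2 * n + k + 1) ^ 2 * (2 * n + k + 2) ^ 2)) := by
  have h1 : (1 / 2 + n : ℝ) = (2 * n + 1) / 2 := by ring
  have h2 : 1 / 2 + k / 2 + n = (2 * n + k + 1) / 2 := by ring
  have h3 : 1 + k / 2 + n = (2 * n + k + 2) / 2 := by ring
  simp only [Uacc2, poch_succ, h1, h2, h3]
  field_simp
  ring

theorem Uacc2_add_one (n : ℕ) {k : ℝ} (hk : 1 + k ≠ 0) :
    Uacc2 n (k + 1) = Uacc2 n k * ((n + k + 1) ^ 2 / (2 * n + k + 1) ^ 2) := by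
  have h1 : poch (1 + (k + 1)) n = poch (1 + k) n * (n + k + 1) / (1 + k) := by
    rw [eq_div_iff hk, mul_comm, ← add_assoc, add_right_comm 1 k 1, add_right_comm 1 1 k,
      mul_poch_add_one]
    ring
  have h2 : poch (1 + (k + 1) / 2) n = poch (1 / 2 + k / 2) n * (2 * n + k + 1) / (1 + k) := by
    have h := mul_poch_add_one (1 / 2 + k / 2) n
    rw [show 1 / 2 + k / 2 + 1 = 1 + (k + 1) / 2 by ring] at h
    rw [eq_div_iff hk]
    linear_combination 2 * h
  have h3 : 1 / 2 + (k + 1) / 2 = 1 + k / 2 := by ring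
  simp only [Uacc2, h1, h2, h3]
  field_simp

theorem zeta2_accelerated_WZ_pair :
    ∀ (n : ℕ) (k : ℝ), k > -1 →
      Facc2 (n + 1) k - Facc2 n k = Gacc2 n (k + 1) - Gacc2 n k := by
  intro n k hk
  have hn : (0 : ℝ) ≤ n := n.cast_nonneg
  have h1 : (n : ℝ) * 2 + 1 ≠ 0 := by positivity
  have h2 : (n : ℝ) * 2 + k + 1 ≠ 0 := by linarith
  have h3 : (n : ℝ) * 2 + k + 2 ≠ 0 := by linarith
  have h4 : (n : ℝ) * 2 + k + 3 ≠ 0 := by linarith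
  simp only [Facc2, Gacc2, Uacc2_succ, Uacc2_add_one n (by linarith : 1 + k ≠ 0),
    pow_succ (1 / 64 : ℝ)]
  push_cast
  rw [show 2 * ((n : ℝ) + 1) + k + 1 = 2 * n + k + 3 by ring,
    show 2 * (n : ℝ) + (k + 1) + 1 = 2 * n + k + 2 by ring,
    show 2 * (n : ℝ) + (k + 1) + 2 = 2 * n + k + 3 by ring]
  generalize Uacc2 n k = u
  generalize (1 / 64 : ℝ) ^ n = c
  field_simp
  ring
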